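/- Assume every closed ball in M is compact. Then there exists a constant c* > 0, depending only on φ, with the following property: for every finite nontrivial Borel measure ν on M, every Borel set A contained in the support of ν, and every constant c > 0 such that limsup_{r→0} ν(B(x,r))/φ(r) > c for all x ∈ A, one has H^φ(A) ≤ (c*/c) ν(M). -/

import Mathlib

open MeasureTheory Set

/-- If every point of `A` is the centre of arbitrarily small closed balls whose mass exceeds
`c * φ (radius)`, then `A` is covered by the fourfold enlargements of countably many
disjoint balls of this kind. -/
theorem exists_countable_disjoint_closedBall_covering {M : Type*} [PseudoMetricSpace M]
    [TopologicalSpace.SeparableSpace M] [MeasurableSpace M] (ν : Measure M) {φ : ℝ → ℝ}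
    (hφpos : ∀ t : ℝ, 0 < t → 0 < φ t) {A : Set M} {c ε : ℝ} (hc : 0 < c) (hε : 0 < ε)
    (hA : ∀ x ∈ A, ENNReal.ofReal c <
      Filter.limsup (fun r : ℝ => ν (Metric.closedBall x r) / ENNReal.ofReal (φ r))
        (nhdsWithin 0 (Ioi (0 : ℝ)))) :
    ∃ (u : Set M) (r : M → ℝ), u.Countable ∧
      (u.PairwiseDisjoint fun x => Metric.closedBall x (r x)) ∧
      (∀ x ∈ u, 0 < r x ∧ r x < ε ∧
        ENNReal.ofReal (φ (r x)) ≤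
          ENNReal.ofReal c⁻¹ * ν (Metric.closedBall x (r x))) ∧
      A ⊆ ⋃ x : u, Metric.closedBall (x : M) (4 * r x) := by
  have hradius : ∀ x, ∃ r : ℝ, x ∈ A → 0 < r ∧ r < ε ∧
      ENNReal.ofReal (φ r) ≤ ENNReal.ofReal c⁻¹ * ν (Metric.closedBall x r) := by
    intro x
    by_cases hx : x ∈ A
    · obtain ⟨r, hr, hr0, hrε⟩ :=
        ((Filter.frequently_lt_of_lt_limsup (by isBoundedDefault) (hA x hx)).and_eventually
          (Ioo_mem_nhdsGT hε)).exists
      refine ⟨r, fun _ => ⟨hr0, hrε, ?_⟩⟩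
      have hφr : ENNReal.ofReal (φ r) ≠ 0 := by simpa using hφpos r hr0
      have hmul := (ENNReal.le_div_iff_mul_le (.inl hφr) (.inl ENNReal.ofReal_ne_top)).1 hr.le
      calc
        ENNReal.ofReal (φ r)
            = ENNReal.ofReal c⁻¹ * (ENNReal.ofReal c * ENNReal.ofReal (φ r)) := by
          rw [← mul_assoc, ← ENNReal.ofReal_mul (inv_nonneg.2 hc.le), inv_mul_cancel₀ hc.ne',
            ENNReal.ofReal_one, one_mul]
        _ ≤ _ := by gcongr
    · exact ⟨0, fun h => absurd h hx⟩
  choose r hr using hradius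
  obtain ⟨u, huA, hdisj, hcov⟩ :=
    Vitali.exists_disjoint_subfamily_covering_enlargement_closedBall A id r ε
      (fun x hx => (hr x hx).2.1.le) 4 (by norm_num)
  refine ⟨u, r, hdisj.countable_of_nonempty_interior fun x hx => ?_, hdisj,
    fun x hx => hr x (huA hx), fun x hx => ?_⟩
  · exact ⟨x, Metric.ball_subset_interior_closedBall
      (Metric.mem_ball_self (hr x (huA hx)).1)⟩
  · obtain ⟨y, hy, hxy⟩ := hcov x hx
    exact mem_iUnion.2 ⟨⟨y, hy⟩, hxy (Metric.mem_closedBall_self (hr x hx).1.le)⟩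

/-- The gauge of a fourfold enlargement of a ball is controlled by the gauge of its radius. -/
theorem ofReal_gauge_ediam_closedBall_le {M : Type*} [PseudoMetricSpace M] {φ : ℝ → ℝ}
    (hφmono : MonotoneOn φ (Ici 0)) {η δ : ℝ} (hη : 0 ≤ η)
    (hfo : ∀ t : ℝ, 0 < t → t < δ → φ (3 * t) ≤ η * φ t) (x : M) {r : ℝ} (hr : 0 < r)
    (hrδ : 3 * r < δ) :
    ENNReal.ofReal (φ (Metric.ediam (Metric.closedBall x (4 * r))).toReal) ≤
      ENNReal.ofReal (η ^ 2) * ENNReal.ofReal (φ r) := by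
  rw [← ENNReal.ofReal_mul (by positivity)]
  apply ENNReal.ofReal_le_ofReal
  have hdiam : (Metric.ediam (Metric.closedBall x (4 * r))).toReal ≤ 2 * (4 * r) :=
    Metric.diam_closedBall (by positivity)
  calc
    φ (Metric.ediam (Metric.closedBall x (4 * r))).toReal ≤ φ (3 * (3 * r)) :=
      hφmono ENNReal.toReal_nonneg (mem_Ici.2 (by positivity)) (by linarith)
    _ ≤ η * φ (3 * r) := hfo _ (by positivity) hrδ
    _ ≤ η * (η * φ r) := by gcongr; exact hfo r hr (by linarith)
    _ = η ^ 2 * φ r := by ring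

open MeasureTheory Set

theorem hausdorff_lower_density_bound
    {M : Type*} [MetricSpace M] [CompleteSpace M] [TopologicalSpace.SeparableSpace M]
    [ProperSpace M] [MeasurableSpace M] [BorelSpace M]
    (φ : ℝ → ℝ)
    (hφcont : ContinuousOn φ (Ici 0))
    (hφmono : MonotoneOn φ (Ici 0))
    (hφpos : ∀ t : ℝ, 0 < t → 0 < φ t)
    (hφ0 : φ 0 = 0)
    (hfo : ∃ η : ℝ, 0 < η ∧ ∃ δ : ℝ, 0 < δ ∧ ∀ t : ℝ, 0 < t → t < δ → φ (3 * t) ≤ η * φ t)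
    (Hφ : Measure M)
    (hHφ : Hφ = MeasureTheory.Measure.mkMetric (fun r : ENNReal => ENNReal.ofReal (φ r.toReal)))
    :
    ∃ cstar : ℝ, 0 < cstar ∧
      ∀ (ν : Measure M) (A : Set M) (c : ℝ),
        MeasurableSet A →
        (∀ x ∈ A, ∀ r : ℝ, 0 < r → 0 < ν (Metric.ball x r)) →
        0 < ν univ → ν univ < ⊤ → 0 < c →
        (∀ x ∈ A, ENNReal.ofReal c <
          Filter.limsup (fun r : ℝ => ν (Metric.closedBall x r) / ENNReal.ofReal (φ r))
            (nhdsWithin 0 (Ioi (0:ℝ)))) →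
        Hφ A ≤ ENNReal.ofReal (cstar / c) * ν univ := by
  obtain ⟨η, hη, δ, hδ, hfo⟩ := hfo
  refine ⟨η ^ 2, by positivity, fun ν A c _ _ _ _ hc hA => ?_⟩
  set ε : ℕ → ℝ := fun n => min (δ / 3) (1 / ((n : ℝ) + 1))
  have hε : ∀ n, 0 < ε n := fun n => by positivity
  choose u r hcount hdisj hr hcov using fun n =>
    exists_countable_disjoint_closedBall_covering ν hφpos hc (hε n) hA
  have hlim : Filter.Tendsto (fun n : ℕ => ENNReal.ofReal (8 * (1 / ((n : ℝ) + 1))))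
      Filter.atTop (nhds 0) := by
    simpa using ENNReal.tendsto_ofReal
      ((tendsto_one_div_add_atTop_nhds_zero_nat (𝕜 := ℝ)).const_mul 8)
  have hcountable : ∀ n, Countable (u n) := fun n => (hcount n).to_subtype
  rw [hHφ]
  refine (Measure.mkMetric_le_liminf_tsum A _ hlim
    (fun n (x : u n) => Metric.closedBall (x : M) (4 * r n x))
    (.of_forall fun n x => ?_) (.of_forall hcov) _).trans ?_
  · obtain ⟨hr0, hrε, -⟩ := hr n x x.2
    refine Metric.ediam_le_of_forall_dist_le fun y hy z hz => ?_
    have hyz := dist_triangle_right y z (x : M)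
    have := hrε.trans_le (min_le_right _ _)
    rw [Metric.mem_closedBall] at hy hz
    linarith
  · refine Filter.liminf_le_of_le (by isBoundedDefault) fun b hb => ?_
    obtain ⟨n, hn⟩ := hb.exists
    refine hn.trans ?_
    calc
      _ ≤ ∑' x : u n, ENNReal.ofReal (η ^ 2 / c) *
            ν (Metric.closedBall (x : M) (r n x)) := by
        refine ENNReal.tsum_le_tsum fun x => ?_
        obtain ⟨hr0, hrε, hν⟩ := hr n x x.2
        refine (ofReal_gauge_ediam_closedBall_le hφmono hη.le hfo (x : M) hr0 ?_).trans ?_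
        · have := hrε.trans_le (min_le_left _ _)
          linarith
        · rw [div_eq_mul_inv, ENNReal.ofReal_mul (by positivity), mul_assoc]
          gcongr
      _ = ENNReal.ofReal (η ^ 2 / c) *
            ∑' x : u n, ν (Metric.closedBall (x : M) (r n x)) := ENNReal.tsum_mul_left
      _ ≤ ENNReal.ofReal (η ^ 2 / c) * ν univ := by
        gcongr
        exact (tsum_meas_le_meas_iUnion_of_disjoint ν
          (fun x : u n => Metric.isClosed_closedBall.measurableSet)
          ((hdisj n).subtype _ _)).trans (measure_mono (subset_univ _))
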